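/- arXiv:1710.07245 — 2 statements merged into one kernel-verified Lean document; each statement's English description precedes it below -/
import Mathlib

section
/- Let (λ_{b,n}, λ_{a,n}), n ∈ ℕ, be eigenvalue pairs as in the context, with λ_{b,n} > 0 and λ_{a,n} > 0 for n ≥ 1. Fix t_f ≥ t, N_ε > 0, M ∈ ℕ and real coefficients C_0, …, C_M, and define u(x,t) := Σ_{n=0}^{M} C_n·e^{λ̄_n·(t_f−t)}·φ_n(x) and its cut-off projection (P_ε u)(x,t) := Σ_{n≤M, λ̄_n ≤ N_ε} C_n·e^{λ̄_n·(t_f−t)}·φ_n(x). Then ∫_{−b}^{a} (u − P_ε u)(x,t)² dx ≤ (min{K_b/κ_b, K_a/κ_a, 1})⁻¹ · max{K_a, K_b, 1} · N_ε⁻¹ · ∫_{−b}^{a} (∂_x u(x,t))² dx. -/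
open MeasureTheory intervalIntegral

/-- The left-slab eigenfunction `φ_b(x) = cos(λb(x+b))/cos(λb·b)`. -/
noncomputable def phiB (lb b x : ℝ) : ℝ := Real.cos (lb * (x + b)) / Real.cos (lb * b)

/-- The right-slab eigenfunction `φ_a(x) = cos(λa(x−a))/cos(λa·a)`. -/
noncomputable def phiA (la a x : ℝ) : ℝ := Real.cos (la * (x - a)) / Real.cos (la * a)

/-- The eigenfunction on the whole system `[-b,a]`: `φ_b` on `[-b,0]`, `φ_a` on `(0,a]`. -/
noncomputable def phiFun (a b lb la x : ℝ) : ℝ := if x ≤ 0 then phiB lb b x else phiA la a x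

/-- `(λb, λa)` is an eigenvalue pair of the two-slab system. -/
def IsEigenPair (Ka Kb ka kb a b lb la : ℝ) : Prop :=
  0 ≤ lb ∧ 0 ≤ la ∧ kb * lb ^ 2 = ka * la ^ 2 ∧
    Kb / Real.sqrt kb * Real.sin (lb * b) * Real.cos (la * a)
      + Ka / Real.sqrt ka * Real.sin (la * a) * Real.cos (lb * b) = 0

/-- Derivative of `phiB` in the space variable. -/
noncomputable def dphiB (lb b x : ℝ) : ℝ := -(lb * Real.sin (lb * (x + b))) / Real.cos (lb * b)

/-- Derivative of `phiA` in the space variable. -/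
noncomputable def dphiA (la a x : ℝ) : ℝ := -(la * Real.sin (la * (x - a))) / Real.cos (la * a)

lemma continuous_phiB (lb b : ℝ) : Continuous (phiB lb b) := by
  unfold phiB; fun_prop

lemma continuous_phiA (la a : ℝ) : Continuous (phiA la a) := by
  unfold phiA; fun_prop

lemma continuous_dphiB (lb b : ℝ) : Continuous (dphiB lb b) := by
  unfold dphiB; fun_prop

lemma continuous_dphiA (la a : ℝ) : Continuous (dphiA la a) := by
  unfold dphiA; fun_prop

lemma hasDerivAt_phiB (lb b x : ℝ) : HasDerivAt (phiB lb b) (dphiB lb b x) x := by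
  have h : HasDerivAt (fun y : ℝ => lb * (y + b)) lb x := by
    simpa using ((hasDerivAt_id x).add_const b).const_mul lb
  refine (h.cos.div_const (Real.cos (lb * b))).congr_deriv ?_
  unfold dphiB; ring

lemma hasDerivAt_dphiB (lb b x : ℝ) :
    HasDerivAt (dphiB lb b) (-(lb ^ 2 * phiB lb b x)) x := by
  have h : HasDerivAt (fun y : ℝ => lb * (y + b)) lb x := by
    simpa using ((hasDerivAt_id x).add_const b).const_mul lb
  refine ((h.sin.const_mul lb).fun_neg.div_const (Real.cos (lb * b))).congr_deriv ?_
  unfold phiB; ring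

lemma phiA_eq_phiB (la a : ℝ) : phiA la a = phiB la (-a) := by
  funext x; simp [phiA, phiB, sub_eq_add_neg]

lemma dphiA_eq_dphiB (la a : ℝ) : dphiA la a = dphiB la (-a) := by
  funext x; simp [dphiA, dphiB, sub_eq_add_neg]

lemma hasDerivAt_phiA (la a x : ℝ) : HasDerivAt (phiA la a) (dphiA la a x) x := by
  rw [phiA_eq_phiB, dphiA_eq_dphiB]; exact hasDerivAt_phiB _ _ _

/-- Green's identity for two left-slab eigenfunctions. -/
lemma integral_dphiB_mul_dphiB (l m b : ℝ) (hm : Real.cos (m * b) ≠ 0) :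
    ∫ x in (-b)..0, dphiB l b x * dphiB m b x =
      l ^ 2 * (∫ x in (-b)..0, phiB l b x * phiB m b x) + dphiB l b 0 := by
  have hcl := continuous_phiB l b
  have hcm := continuous_phiB m b
  have hdl := continuous_dphiB l b
  have hdm := continuous_dphiB m b
  have key : ∫ x in (-b)..0,
      (-(l ^ 2 * phiB l b x) * phiB m b x + dphiB l b x * dphiB m b x) =
      dphiB l b 0 * phiB m b 0 - dphiB l b (-b) * phiB m b (-b) := by
    refine integral_eq_sub_of_hasDerivAt
      (fun x _ => (hasDerivAt_dphiB l b x).mul (hasDerivAt_phiB m b x)) ?_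
    exact Continuous.intervalIntegrable (by fun_prop) _ _
  have h0 : phiB m b 0 = 1 := by simp [phiB, hm]
  have h1 : dphiB l b (-b) = 0 := by simp [dphiB]
  rw [intervalIntegral.integral_add (Continuous.intervalIntegrable (by fun_prop) _ _)
    (Continuous.intervalIntegrable (by fun_prop) _ _), h0, h1] at key
  have h2 : ∫ x in (-b)..0, -(l ^ 2 * phiB l b x) * phiB m b x =
      -(l ^ 2 * ∫ x in (-b)..0, phiB l b x * phiB m b x) := by
    rw [← intervalIntegral.integral_const_mul, ← intervalIntegral.integral_neg]
    congr 1; funext x; ring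
  linarith

/-- Green's identity for two right-slab eigenfunctions. -/
lemma integral_dphiA_mul_dphiA (l m a : ℝ) (hm : Real.cos (m * a) ≠ 0) :
    ∫ x in 0..a, dphiA l a x * dphiA m a x =
      l ^ 2 * (∫ x in 0..a, phiA l a x * phiA m a x) - dphiA l a 0 := by
  have h := integral_dphiB_mul_dphiB l m (-a) (by simpa using hm)
  rw [neg_neg, integral_symm, integral_symm (0 : ℝ) a] at h
  simp only [phiA_eq_phiB, dphiA_eq_dphiB]
  linarith

/-- Continuity of the heat flux across the interface. -/
lemma IsEigenPair.flux_eq {Ka Kb ka kb a b lb la : ℝ} (hka : 0 < ka) (hkb : 0 < kb)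
    (h : IsEigenPair Ka Kb ka kb a b lb la)
    (hcb : Real.cos (lb * b) ≠ 0) (hca : Real.cos (la * a) ≠ 0) :
    Kb * dphiB lb b 0 = Ka * dphiA la a 0 := by
  obtain ⟨hlb, hla, hl, he⟩ := h
  have hsb := Real.sqrt_pos.2 hkb
  have hsa := Real.sqrt_pos.2 hka
  have hs : Real.sqrt kb * lb = Real.sqrt ka * la := by
    rw [← sq_eq_sq₀ (by positivity) (by positivity), mul_pow, mul_pow, Real.sq_sqrt hkb.le,
      Real.sq_sqrt hka.le, hl]
  have e : Kb * lb * Real.sin (lb * b) * Real.cos (la * a)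
      + Ka * la * Real.sin (la * a) * Real.cos (lb * b) = 0 := by
    have e1 : Kb * lb = Kb / Real.sqrt kb * (Real.sqrt kb * lb) := by field_simp
    have e2 : Ka * la = Ka / Real.sqrt ka * (Real.sqrt kb * lb) := by rw [hs]; field_simp
    rw [e1, e2]
    linear_combination (Real.sqrt kb * lb) * he
  simp only [dphiB, dphiA, zero_add, zero_sub, mul_neg, Real.sin_neg]
  field_simp
  linear_combination -e

lemma integral_sq_sum (s : Finset ℕ) (c : ℕ → ℝ) (F : ℕ → ℝ → ℝ) (hF : ∀ n, Continuous (F n))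
    (p q : ℝ) :
    ∫ x in p..q, (∑ n ∈ s, c n * F n x) ^ 2 =
      ∑ n ∈ s, ∑ m ∈ s, c n * c m * ∫ x in p..q, F n x * F m x := by
  simp_rw [sq, Finset.sum_mul_sum]
  rw [intervalIntegral.integral_finsetSum
    fun n _ => Continuous.intervalIntegrable (by fun_prop) _ _]
  refine Finset.sum_congr rfl fun n _ => ?_
  rw [intervalIntegral.integral_finsetSum
    fun m _ => Continuous.intervalIntegrable (by fun_prop) _ _]
  refine Finset.sum_congr rfl fun m _ => ?_
  rw [← intervalIntegral.integral_const_mul]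
  congr 1; funext x; ring

/-- The integral of a function which agrees with continuous functions on the interiors of two
adjacent intervals. -/
lemma integral_eq_add_of_eqOn_Ioo {p q r : ℝ} (hpq : p ≤ q) (hqr : q ≤ r) {f g h : ℝ → ℝ}
    (hg : Continuous g) (hh : Continuous h) (hfg : Set.EqOn f g (Set.Ioo p q))
    (hfh : Set.EqOn f h (Set.Ioo q r)) :
    ∫ x in p..r, f x = (∫ x in p..q, g x) + ∫ x in q..r, h x := by
  have hfg' : Set.EqOn g f (Set.uIoo p q) := by rw [Set.uIoo_of_le hpq]; exact hfg.symm
  have hfh' : Set.EqOn h f (Set.uIoo q r) := by rw [Set.uIoo_of_le hqr]; exact hfh.symm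
  rw [← integral_add_adjacent_intervals ((hg.intervalIntegrable p q).congr_uIoo hfg')
    ((hh.intervalIntegrable q r).congr_uIoo hfh'), integral_congr_uIoo hfg',
    integral_congr_uIoo hfh']

lemma sum_sum_eq_sum_diag (s : Finset ℕ) (c : ℕ → ℝ) (P : ℕ → ℕ → ℝ)
    (hP : ∀ n m, n ≠ m → P n m = 0) :
    ∑ n ∈ s, ∑ m ∈ s, c n * c m * P n m = ∑ n ∈ s, c n ^ 2 * P n n := by
  refine Finset.sum_congr rfl fun n hn => ?_
  rw [Finset.sum_eq_single_of_mem n hn fun m _ hmn => by rw [hP n m hmn.symm, mul_zero]]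
  ring

/-- The error of the cut-off projection of a truncated Fourier
solution is bounded by
`(min{Kb/κb, Ka/κa, 1})⁻¹·max{Ka, Kb, 1}·N_ε⁻¹` times the Dirichlet energy. -/
theorem cutoff_projection_truncation_error
    (a b Ka Kb ka kb : ℝ) (ha : 0 < a) (hb : 0 < b)
    (hKa : 0 < Ka) (hKb : 0 < Kb) (hka : 0 < ka) (hkb : 0 < kb)
    (lb la : ℕ → ℝ)
    (hpair : ∀ n, IsEigenPair Ka Kb ka kb a b (lb n) (la n))
    (hcosb : ∀ n, Real.cos (lb n * b) ≠ 0) (hcosa : ∀ n, Real.cos (la n * a) ≠ 0)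
    (hmono : StrictMono fun n => kb * lb n ^ 2)
    (hposb : ∀ n, 1 ≤ n → 0 < lb n) (hposa : ∀ n, 1 ≤ n → 0 < la n)
    (t tf Nε : ℝ) (htf : t ≤ tf) (hNε : 0 < Nε) (M : ℕ) (C : ℕ → ℝ) :
    (∫ x in (-b)..a,
        ((∑ n ∈ Finset.range (M + 1),
            C n * Real.exp (kb * lb n ^ 2 * (tf - t)) * phiFun a b (lb n) (la n) x)
          - ∑ n ∈ (Finset.range (M + 1)).filter (fun n => kb * lb n ^ 2 ≤ Nε),
              C n * Real.exp (kb * lb n ^ 2 * (tf - t)) * phiFun a b (lb n) (la n) x) ^ 2)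
      ≤ (min (min (Kb / kb) (Ka / ka)) 1)⁻¹ * max (max Ka Kb) 1 * Nε⁻¹ *
          ∫ x in (-b)..a,
            (deriv (fun y => ∑ n ∈ Finset.range (M + 1),
              C n * Real.exp (kb * lb n ^ 2 * (tf - t)) * phiFun a b (lb n) (la n) y) x) ^ 2 := by
  obtain ⟨c, hc⟩ : ∃ c : ℕ → ℝ, ∀ n, c n = C n * Real.exp (kb * lb n ^ 2 * (tf - t)) :=
    ⟨_, fun _ => rfl⟩
  simp only [← hc]
  set S := Finset.range (M + 1)
  set T := S.filter (fun n => ¬ kb * lb n ^ 2 ≤ Nε) with hT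
  have hsplit : ∀ x, (∑ n ∈ S, c n * phiFun a b (lb n) (la n) x)
      - ∑ n ∈ S.filter (fun n => kb * lb n ^ 2 ≤ Nε), c n * phiFun a b (lb n) (la n) x
      = ∑ n ∈ T, c n * phiFun a b (lb n) (la n) x := fun x => by
    rw [sub_eq_iff_eq_add', hT, Finset.sum_filter_add_sum_filter_not]
  simp only [hsplit]
  have cB := fun n => continuous_phiB (lb n) b
  have cA := fun n => continuous_phiA (la n) a
  have dB := fun n => continuous_dphiB (lb n) b
  have dA := fun n => continuous_dphiA (la n) a
  have hL : ∫ x in (-b)..a, (∑ n ∈ T, c n * phiFun a b (lb n) (la n) x) ^ 2 =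
      (∫ x in (-b)..0, (∑ n ∈ T, c n * phiB (lb n) b x) ^ 2) +
        ∫ x in 0..a, (∑ n ∈ T, c n * phiA (la n) a x) ^ 2 := by
    refine integral_eq_add_of_eqOn_Ioo (by linarith) ha.le (by fun_prop) (by fun_prop) ?_ ?_
    · intro x hx
      simp [phiFun, hx.2.le]
    · intro x hx
      simp [phiFun, not_le.2 hx.1]
  have hR : ∫ x in (-b)..a,
      (deriv (fun y => ∑ n ∈ S, c n * phiFun a b (lb n) (la n) y) x) ^ 2 =
      (∫ x in (-b)..0, (∑ n ∈ S, c n * dphiB (lb n) b x) ^ 2) +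
        ∫ x in 0..a, (∑ n ∈ S, c n * dphiA (la n) a x) ^ 2 := by
    refine integral_eq_add_of_eqOn_Ioo (by linarith) ha.le (by fun_prop) (by fun_prop) ?_ ?_
    · intro x hx
      have hd : HasDerivAt (fun y => ∑ n ∈ S, c n * phiB (lb n) b y)
          (∑ n ∈ S, c n * dphiB (lb n) b x) x :=
        HasDerivAt.fun_sum fun n _ => (hasDerivAt_phiB (lb n) b x).const_mul (c n)
      have he : (fun y => ∑ n ∈ S, c n * phiFun a b (lb n) (la n) y) =ᶠ[nhds x]
          fun y => ∑ n ∈ S, c n * phiB (lb n) b y := by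
        filter_upwards [Iio_mem_nhds hx.2] with y hy
        simp [phiFun, (Set.mem_Iio.1 hy).le]
      simp only [(hd.congr_of_eventuallyEq he).deriv]
    · intro x hx
      have hd : HasDerivAt (fun y => ∑ n ∈ S, c n * phiA (la n) a y)
          (∑ n ∈ S, c n * dphiA (la n) a x) x :=
        HasDerivAt.fun_sum fun n _ => (hasDerivAt_phiA (la n) a x).const_mul (c n)
      have he : (fun y => ∑ n ∈ S, c n * phiFun a b (lb n) (la n) y) =ᶠ[nhds x]
          fun y => ∑ n ∈ S, c n * phiA (la n) a y := by
        filter_upwards [Ioi_mem_nhds hx.1] with y hy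
        simp [phiFun, not_le.2 (Set.mem_Ioi.1 hy)]
      simp only [(hd.congr_of_eventuallyEq he).deriv]
  rw [hL, hR]
  obtain ⟨P, hP⟩ : ∃ P : ℕ → ℕ → ℝ, ∀ n m, P n m =
      Kb / kb * (∫ x in (-b)..0, phiB (lb n) b x * phiB (lb m) b x) +
        Ka / ka * ∫ x in 0..a, phiA (la n) a x * phiA (la m) a x := ⟨_, fun _ _ => rfl⟩
  obtain ⟨D, hD⟩ : ∃ D : ℕ → ℕ → ℝ, ∀ n m, D n m =
      Kb * (∫ x in (-b)..0, dphiB (lb n) b x * dphiB (lb m) b x) +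
        Ka * ∫ x in 0..a, dphiA (la n) a x * dphiA (la m) a x := ⟨_, fun _ _ => rfl⟩
  have hDP : ∀ n m, D n m = kb * lb n ^ 2 * P n m := fun n m => by
    have hf := (hpair n).flux_eq hka hkb (hcosb n) (hcosa n)
    have hl := (hpair n).2.2.1
    have e1 : kb * lb n ^ 2 * (Ka / ka) = Ka * la n ^ 2 := by rw [hl]; field_simp
    have e2 : kb * lb n ^ 2 * (Kb / kb) = Kb * lb n ^ 2 := by field_simp
    rw [hD, hP, integral_dphiB_mul_dphiB _ _ _ (hcosb m), integral_dphiA_mul_dphiA _ _ _ (hcosa m),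
      mul_add (kb * lb n ^ 2), ← mul_assoc (kb * lb n ^ 2), ← mul_assoc (kb * lb n ^ 2), e1, e2]
    linear_combination hf
  have hPs : ∀ n m, P n m = P m n := fun n m => by
    simp only [hP, mul_comm]
  have hDs : ∀ n m, D n m = D m n := fun n m => by
    simp only [hD, mul_comm]
  have hP0 : ∀ n m, n ≠ m → P n m = 0 := fun n m hnm => by
    have h1 : (kb * lb n ^ 2 - kb * lb m ^ 2) * P n m = 0 := by
      linear_combination hDs n m - hDP n m + hDP m n - kb * lb m ^ 2 * hPs n m
    exact (mul_eq_zero.1 h1).resolve_left (sub_ne_zero.2 (hmono.injective.ne hnm))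
  have hD0 : ∀ n m, n ≠ m → D n m = 0 := fun n m hnm => by rw [hDP, hP0 n m hnm, mul_zero]
  have hPnn : ∀ n, 0 ≤ P n n := fun n => by
    rw [hP]
    have h1 : 0 ≤ ∫ x in (-b)..0, phiB (lb n) b x * phiB (lb n) b x :=
      integral_nonneg (by linarith) fun x _ => mul_self_nonneg _
    have h2 : 0 ≤ ∫ x in 0..a, phiA (la n) a x * phiA (la n) a x :=
      integral_nonneg ha.le fun x _ => mul_self_nonneg _
    positivity
  obtain ⟨I1, hI1⟩ : ∃ I, I = ∫ x in (-b)..0, (∑ n ∈ T, c n * phiB (lb n) b x) ^ 2 := ⟨_, rfl⟩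
  obtain ⟨I2, hI2⟩ : ∃ I, I = ∫ x in 0..a, (∑ n ∈ T, c n * phiA (la n) a x) ^ 2 := ⟨_, rfl⟩
  obtain ⟨J1, hJ1⟩ : ∃ I, I = ∫ x in (-b)..0, (∑ n ∈ S, c n * dphiB (lb n) b x) ^ 2 := ⟨_, rfl⟩
  obtain ⟨J2, hJ2⟩ : ∃ I, I = ∫ x in 0..a, (∑ n ∈ S, c n * dphiA (la n) a x) ^ 2 := ⟨_, rfl⟩
  rw [← hI1, ← hI2, ← hJ1, ← hJ2]
  have nI1 : 0 ≤ I1 := hI1 ▸ integral_nonneg (by linarith) fun x _ => sq_nonneg _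
  have nI2 : 0 ≤ I2 := hI2 ▸ integral_nonneg ha.le fun x _ => sq_nonneg _
  have nJ1 : 0 ≤ J1 := hJ1 ▸ integral_nonneg (by linarith) fun x _ => sq_nonneg _
  have nJ2 : 0 ≤ J2 := hJ2 ▸ integral_nonneg ha.le fun x _ => sq_nonneg _
  have hI : Kb / kb * I1 + Ka / ka * I2 = ∑ n ∈ T, c n ^ 2 * P n n := by
    rw [← sum_sum_eq_sum_diag T c P hP0, hI1, hI2, integral_sq_sum T c _ cB,
      integral_sq_sum T c _ cA]
    simp only [Finset.mul_sum, ← Finset.sum_add_distrib, hP]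
    exact Finset.sum_congr rfl fun n _ => Finset.sum_congr rfl fun m _ => by ring
  have hJ : Kb * J1 + Ka * J2 = ∑ n ∈ S, c n ^ 2 * D n n := by
    rw [← sum_sum_eq_sum_diag S c D hD0, hJ1, hJ2, integral_sq_sum S c _ dB,
      integral_sq_sum S c _ dA]
    simp only [Finset.mul_sum, ← Finset.sum_add_distrib, hD]
    exact Finset.sum_congr rfl fun n _ => Finset.sum_congr rfl fun m _ => by ring
  have hmain : Nε * (Kb / kb * I1 + Ka / ka * I2) ≤ Kb * J1 + Ka * J2 := by
    rw [hI, hJ, Finset.mul_sum]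
    refine (Finset.sum_le_sum fun n hn => ?_).trans
      (Finset.sum_le_sum_of_subset_of_nonneg (Finset.filter_subset _ _) fun n _ _ => ?_)
    · have hn' : Nε ≤ kb * lb n ^ 2 := (not_le.1 (Finset.mem_filter.1 hn).2).le
      have h1 : 0 ≤ c n ^ 2 * P n n := mul_nonneg (sq_nonneg _) (hPnn n)
      rw [hDP]
      linarith [mul_le_mul_of_nonneg_right hn' h1]
    · rw [hDP]
      have := hPnn n
      positivity
  obtain ⟨μ, hμ⟩ : ∃ μ, μ = min (min (Kb / kb) (Ka / ka)) 1 := ⟨_, rfl⟩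
  obtain ⟨ν, hν⟩ : ∃ ν, ν = max (max Ka Kb) 1 := ⟨_, rfl⟩
  have hμ0 : 0 < μ := by rw [hμ]; positivity
  have hμb : μ ≤ Kb / kb := hμ ▸ (min_le_left _ _).trans (min_le_left _ _)
  have hμa : μ ≤ Ka / ka := hμ ▸ (min_le_left _ _).trans (min_le_right _ _)
  have hνa : Ka ≤ ν := hν ▸ (le_max_left _ _).trans (le_max_left _ _)
  have hνb : Kb ≤ ν := hν ▸ (le_max_right _ _).trans (le_max_left _ _)
  rw [← hμ, ← hν]
  have hfin : Nε * (μ * (I1 + I2)) ≤ ν * (J1 + J2) := by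
    calc Nε * (μ * (I1 + I2)) = Nε * (μ * I1 + μ * I2) := by ring
      _ ≤ Nε * (Kb / kb * I1 + Ka / ka * I2) := by gcongr
      _ ≤ Kb * J1 + Ka * J2 := hmain
      _ ≤ ν * J1 + ν * J2 := by gcongr
      _ = ν * (J1 + J2) := by ring
  calc I1 + I2 = μ⁻¹ * Nε⁻¹ * (Nε * (μ * (I1 + I2))) := by field_simp
    _ ≤ μ⁻¹ * Nε⁻¹ * (ν * (J1 + J2)) := by gcongr
    _ = μ⁻¹ * ν * Nε⁻¹ * (J1 + J2) := by ring
end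

section
/- Let t_f > 0, β ∈ (0,1), γ ∈ (0,1], and for ε ∈ (0,1) set N_ε := β·ln(ε^{−γ})/t_f. Then for every t ∈ [0, t_f] and every ε ∈ (0,1) with N_ε > 0, one has the identity N_ε^{1/2}·e^{N_ε·(t_f−t)}·ε + N_ε^{−1/2} = √(β/t_f)·(ln(ε^{−γ}))^{1/2}·ε^{1−γ·(1−t/t_f)·β} + √(t_f/β)·(ln(ε^{−γ}))^{−1/2}, and this quantity tends to 0 as ε → 0⁺, uniformly in t ∈ [0, t_f]. -/
open Filter Topology in
/-- The profile `√x · e^{-cx} + 1/√x` vanishes at infinity for `c > 0`. -/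
theorem tendsto_sqrt_mul_exp_neg_mul_add_inv_sqrt {c : ℝ} (hc : 0 < c) :
    Tendsto (fun x : ℝ => Real.sqrt x * Real.exp (-c * x) + (Real.sqrt x)⁻¹) atTop (𝓝 0) := by
  have h₁ := tendsto_rpow_mul_exp_neg_mul_atTop_nhds_zero (1 / 2) c hc
  simp only [← Real.sqrt_eq_rpow] at h₁
  simpa using h₁.add Real.tendsto_sqrt_atTop.inv_tendsto_atTop

open Filter Topology in
/-- The regularization parameter `β·ln(ε^{−γ})/t_f` blows up as the noise level vanishes. -/
theorem tendsto_regularization_parameter {tf β γ : ℝ} (htf : 0 < tf) (hβ : 0 < β) (hγ : 0 < γ) :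
    Tendsto (fun ε : ℝ => β * Real.log (ε ^ (-γ)) / tf) (𝓝[>] 0) atTop := by
  have h : Tendsto (fun ε : ℝ => -(β * γ / tf) * Real.log ε) (𝓝[>] 0) atTop :=
    Real.tendsto_log_nhdsGT_zero.const_mul_atBot_of_neg (neg_lt_zero.mpr (by positivity))
  refine h.congr' ?_
  filter_upwards [self_mem_nhdsWithin] with ε hε
  rw [Real.log_rpow hε]
  ring

/-- The amplified noise is largest at `t = 0`, where it still decays exponentially in the
regularization parameter. -/
theorem exp_regularization_parameter_mul_le {tf β γ ε t : ℝ} (htf : 0 < tf) (hβ : 0 < β)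
    (hγ : γ ∈ Set.Ioc (0 : ℝ) 1) (hε : ε ∈ Set.Ioo (0 : ℝ) 1) (ht : 0 ≤ t) :
    Real.exp (β * Real.log (ε ^ (-γ)) / tf * (tf - t)) * ε
      ≤ Real.exp (-((1 - β) * tf / β) * (β * Real.log (ε ^ (-γ)) / tf)) := by
  have hlog : Real.log ε < 0 := Real.log_neg hε.1 hε.2
  have hN : 0 ≤ β * (-γ * Real.log ε) / tf * t := by
    have : 0 < -γ * Real.log ε := mul_pos_of_neg_of_neg (neg_lt_zero.mpr hγ.1) hlog
    positivity
  have hγlog : 0 ≤ (1 - γ) * -Real.log ε :=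
    mul_nonneg (sub_nonneg.mpr hγ.2) (neg_nonneg.mpr hlog.le)
  rw [Real.log_rpow hε.1]
  nth_rewrite 2 [← Real.exp_log hε.1]
  rw [← Real.exp_add, Real.exp_le_exp]
  have h₁ : β * (-γ * Real.log ε) / tf * (tf - t)
      = β * (-γ * Real.log ε) - β * (-γ * Real.log ε) / tf * t := by
    field_simp
    ring
  have h₂ : -((1 - β) * tf / β) * (β * (-γ * Real.log ε) / tf)
      = -(1 - β) * (-γ * Real.log ε) := by
    field_simp
  rw [h₁, h₂]
  linarith


/-- For `N_ε = β·ln(ε^{−γ})/t_f` the error bound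
`N_ε^{1/2}·e^{N_ε(t_f−t)}·ε + N_ε^{−1/2}` equals
`√(β/t_f)·(ln(ε^{−γ}))^{1/2}·ε^{1−γ(1−t/t_f)β} + √(t_f/β)·(ln(ε^{−γ}))^{−1/2}`,
and tends to `0` as `ε → 0⁺`, uniformly in `t ∈ [0, t_f]`. -/
theorem regularization_parameter_error_bound
    (tf β γ : ℝ) (htf : 0 < tf) (hβ : β ∈ Set.Ioo (0 : ℝ) 1)
    (hγ : γ ∈ Set.Ioc (0 : ℝ) 1) :
    (∀ ε ∈ Set.Ioo (0 : ℝ) 1, ∀ t ∈ Set.Icc (0 : ℝ) tf,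
      0 < β * Real.log (ε ^ (-γ)) / tf →
        Real.sqrt (β * Real.log (ε ^ (-γ)) / tf)
            * Real.exp (β * Real.log (ε ^ (-γ)) / tf * (tf - t)) * ε
          + (Real.sqrt (β * Real.log (ε ^ (-γ)) / tf))⁻¹
        = Real.sqrt (β / tf) * Real.log (ε ^ (-γ)) ^ ((1 : ℝ) / 2)
              * ε ^ (1 - γ * (1 - t / tf) * β)
          + Real.sqrt (tf / β) * Real.log (ε ^ (-γ)) ^ (-(1 : ℝ) / 2)) ∧
    (∀ δ > (0 : ℝ), ∃ ε₀ ∈ Set.Ioo (0 : ℝ) 1, ∀ ε : ℝ, 0 < ε → ε < ε₀ →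
      ∀ t ∈ Set.Icc (0 : ℝ) tf,
        Real.sqrt (β * Real.log (ε ^ (-γ)) / tf)
            * Real.exp (β * Real.log (ε ^ (-γ)) / tf * (tf - t)) * ε
          + (Real.sqrt (β * Real.log (ε ^ (-γ)) / tf))⁻¹ < δ) := by
  obtain ⟨hβ₀, hβ₁⟩ := hβ
  constructor
  · intro ε hε t _ hN
    have hL : 0 < Real.log (ε ^ (-γ)) := by
      have h := (div_pos_iff_of_pos_right htf).mp hN
      exact (mul_pos_iff_of_pos_left hβ₀).mp h
    have hexp : Real.exp (β * Real.log (ε ^ (-γ)) / tf * (tf - t)) * ε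
        = ε ^ (1 - γ * (1 - t / tf) * β) := by
      rw [Real.log_rpow hε.1, Real.rpow_def_of_pos hε.1]
      nth_rewrite 2 [← Real.exp_log hε.1]
      rw [← Real.exp_add]
      congr 1
      field_simp
      ring
    have hsqrt : Real.sqrt (β * Real.log (ε ^ (-γ)) / tf)
        = Real.sqrt (β / tf) * Real.log (ε ^ (-γ)) ^ ((1 : ℝ) / 2) := by
      rw [← Real.sqrt_eq_rpow, ← Real.sqrt_mul (by positivity)]
      congr 1
      ring
    rw [mul_assoc, hexp, hsqrt, mul_inv, ← Real.sqrt_inv, inv_div, ← Real.rpow_neg hL.le, neg_div]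
  · intro δ hδ
    have hc : 0 < (1 - β) * tf / β := by
      have := sub_pos.mpr hβ₁
      positivity
    have hlim := (tendsto_sqrt_mul_exp_neg_mul_add_inv_sqrt hc).comp
      (tendsto_regularization_parameter htf hβ₀ hγ.1)
    obtain ⟨u, hu, hsub⟩ := mem_nhdsGT_iff_exists_Ioo_subset.mp (hlim.eventually (gt_mem_nhds hδ))
    refine ⟨min u (1 / 2), ⟨lt_min hu (by norm_num), (min_le_right _ _).trans_lt (by norm_num)⟩, ?_⟩
    intro ε hε hεu t ht
    have hε₁ : ε < 1 := (hεu.trans_le (min_le_right _ _)).trans (by norm_num)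
    refine lt_of_le_of_lt ?_ (hsub ⟨hε, hεu.trans_le (min_le_left _ _)⟩)
    rw [mul_assoc]
    exact add_le_add_left (mul_le_mul_of_nonneg_left
      (exp_regularization_parameter_mul_le htf hβ₀ hγ ⟨hε, hε₁⟩ ht.1) (Real.sqrt_nonneg _)) _
end
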